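/- arXiv:2404.16338 — 2 statements merged into one kernel-verified Lean document; each statement's English description precedes it below -/
import Mathlib

section
/- The function F(s) := Σ_{n=2}^∞ n^{−2s} / log n, which is holomorphic on {s ∈ ℂ : Re s > 1/2}, admits no meromorphic continuation to the complex plane: there is no function h that is meromorphic on all of ℂ and satisfies h(s) = F(s) for every s with Re s > 1/2. -/
noncomputable section

/-- The term `n^{−2s}/log n` (for `n ≥ 2`, indexed by `n - 2`), where
`n^{−2s} := exp(−2s · log n)` with the real logarithm. -/
def Fterm (s : ℂ) (n : ℕ) : ℂ :=
  Complex.exp (-2 * s * (Real.log ((n : ℝ) + 2) : ℂ)) / (Real.log ((n : ℝ) + 2) : ℂ)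

/-- `F(s) = Σ_{n=2}^∞ n^{−2s}/log n`. -/
def Ffun (s : ℂ) : ℂ := ∑' n : ℕ, Fterm s n

end

open Filter Topology

/-- The derivative of a meromorphic function has no residue: if `(z - a) * f' z` tends to `c`
along some nontrivial filter of punctured neighbourhoods of `a`, then `c = 0`. -/
theorem MeromorphicAt.eq_zero_of_tendsto_sub_mul_deriv {f : ℂ → ℂ} {a c : ℂ} {l : Filter ℂ}
    [l.NeBot] (hf : MeromorphicAt f a) (hl : l ≤ 𝓝[≠] a)
    (hc : Tendsto (fun z ↦ (z - a) * deriv f z) l (𝓝 c)) : c = 0 := by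
  by_cases htop : meromorphicOrderAt f a = ⊤
  · have hev : ∀ᶠ z in 𝓝[≠] a, f =ᶠ[𝓝 z] fun _ ↦ 0 :=
      eventually_nhdsNE_eventually_nhds_iff.2 (meromorphicOrderAt_eq_top_iff.1 htop)
    refine tendsto_nhds_unique hc (tendsto_const_nhds.congr' ?_)
    filter_upwards [hl hev] with z hz
    simp [hz.deriv_eq]
  obtain ⟨g, hg, hga, hfg⟩ := (meromorphicOrderAt_ne_top_iff hf).1 htop
  set n := (meromorphicOrderAt f a).untop₀
  have hsub : Tendsto (fun z : ℂ ↦ z - a) l (𝓝 0) := by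
    have : Tendsto (fun z : ℂ ↦ z - a) (𝓝 a) (𝓝 (a - a)) := tendsto_id.sub_const a
    rw [sub_self] at this
    exact this.mono_left (hl.trans nhdsWithin_le_nhds)
  have hlim : Tendsto (fun z ↦ n * g z + (z - a) * deriv g z) l (𝓝 (n * g a)) := by
    have h1 := hg.continuousAt.tendsto.mono_left (hl.trans nhdsWithin_le_nhds)
    have h2 := hg.deriv.continuousAt.tendsto.mono_left (hl.trans nhdsWithin_le_nhds)
    simpa using (h1.const_mul (n : ℂ)).add (hsub.mul h2)
  have hne : ∀ᶠ z in l, z ≠ a := hl self_mem_nhdsWithin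
  have hderiv : ∀ᶠ z in l,
      (z - a) * deriv f z = (z - a) ^ n * (n * g z + (z - a) * deriv g z) := by
    have hev : ∀ᶠ z in 𝓝[≠] a, f =ᶠ[𝓝 z] fun z ↦ (z - a) ^ n • g z :=
      eventually_nhdsNE_eventually_nhds_iff.2 hfg
    filter_upwards [hl hev, hne,
      hl (hg.eventually_analyticAt.filter_mono nhdsWithin_le_nhds)] with z hz hza hgz
    have hza' : z - a ≠ 0 := sub_ne_zero.2 hza
    have hd : HasDerivAt (fun z ↦ (z - a) ^ n • g z)
        ((n * (z - a) ^ (n - 1)) * g z + (z - a) ^ n * deriv g z) z :=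
      ((hasDerivAt_zpow n (z - a) (Or.inl hza')).comp_sub_const z a).mul
        hgz.differentiableAt.hasDerivAt
    rw [hz.deriv_eq, hd.deriv, zpow_sub_one₀ hza']
    field_simp
  rcases lt_trichotomy n 0 with hn | hn | hn
  · have hpow : Tendsto (fun z ↦ (z - a) ^ (-n)) l (𝓝 0) := by
      lift -n to ℕ using by omega with m hm
      simpa [show m ≠ 0 by omega] using hsub.pow m
    have hzero : Tendsto (fun z ↦ n * g z + (z - a) * deriv g z) l (𝓝 0) := by
      rw [← zero_mul c]
      refine (hpow.mul hc).congr' ?_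
      filter_upwards [hderiv, hne] with z hz hza
      rw [hz, zpow_neg, inv_mul_cancel_left₀ (zpow_ne_zero _ (sub_ne_zero.2 hza))]
    have := tendsto_nhds_unique hlim hzero
    simp [hga, hn.ne] at this
  · refine tendsto_nhds_unique (hc.congr' hderiv) ?_
    simpa [hn] using hlim
  · have hpow : Tendsto (fun z ↦ (z - a) ^ n) l (𝓝 0) := by
      lift n to ℕ using hn.le with m hm
      simpa [show m ≠ 0 by omega] using hsub.pow m
    refine tendsto_nhds_unique (hc.congr' hderiv) ?_
    simpa using hpow.mul hlim

/-- The coefficients `1 / log n`, equal to `0` for `n = 0` and `n = 1`. -/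
noncomputable def invLogCoeff (n : ℕ) : ℂ := (Complex.log n)⁻¹

theorem abscissaOfAbsConv_invLogCoeff_le : LSeries.abscissaOfAbsConv invLogCoeff ≤ 1 := by
  refine LSeries.abscissaOfAbsConv_le_of_le_const ⟨(Real.log 2)⁻¹, fun n hn ↦ ?_⟩
  have h2 : 0 < Real.log 2 := Real.log_pos one_lt_two
  obtain rfl | hn2 : n = 1 ∨ 2 ≤ n := by omega
  · simp [invLogCoeff, h2.le]
  · have hle : Real.log 2 ≤ Real.log n := Real.log_le_log two_pos (by exact_mod_cast hn2)
    rw [invLogCoeff, ← Complex.natCast_log, norm_inv, Complex.norm_real, Real.norm_eq_abs,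
      abs_of_nonneg (h2.le.trans hle)]
    exact inv_anti₀ h2 hle

theorem Ffun_eq_LSeries (s : ℂ) : Ffun s = LSeries invLogCoeff (2 * s) := by
  have hsupp : Function.support (LSeries.term invLogCoeff (2 * s)) ⊆
      Set.range fun n : ℕ ↦ n + 2 := by
    intro n hn
    refine ⟨n - 2, Nat.sub_add_cancel (not_lt.1 fun h ↦ hn ?_)⟩
    interval_cases n <;> simp [LSeries.term, invLogCoeff]
  rw [Ffun, LSeries, ← (add_left_injective 2).tsum_eq hsupp]
  refine tsum_congr fun n ↦ ?_
  have hlog : Complex.log ((n + 2 : ℕ) : ℂ) = (Real.log ((n : ℝ) + 2) : ℂ) := by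
    rw [← Complex.natCast_log]
    push_cast
    rfl
  rw [LSeries.term_of_ne_zero (by omega), Fterm, invLogCoeff,
    Complex.cpow_def_of_ne_zero (by exact_mod_cast (by omega : n + 2 ≠ 0)), hlog,
    div_eq_mul_inv, div_eq_mul_inv, ← Complex.exp_neg, mul_comm]
  congr 2
  ring

theorem LSeries_logMul_invLogCoeff {s : ℂ} (hs : 1 < s.re) :
    LSeries (LSeries.logMul invLogCoeff) s = riemannZeta s - 1 := by
  have hdelta : LSeries LSeries.delta s = 1 := by rw [LSeries_delta, Pi.one_apply]
  have hsum : LSeriesSummable LSeries.delta s := by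
    refine summable_of_hasFiniteSupport ((Set.finite_singleton 1).subset fun n hn ↦ ?_)
    by_contra h
    exact hn (by simpa [LSeries.term_delta] using h)
  rw [← LSeries_one_eq_riemannZeta hs, ← hdelta,
    ← LSeries_sub (LSeriesSummable_one_iff.2 hs) hsum]
  refine LSeries_congr (fun {n} hn ↦ ?_) s
  obtain rfl | hn2 : n = 1 ∨ 2 ≤ n := by omega
  · simp [LSeries.delta, invLogCoeff]
  · have hlog : Complex.log n ≠ 0 := by
      rw [← Complex.natCast_log]
      exact_mod_cast (Real.log_pos (by exact_mod_cast hn2)).ne'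
    simp [LSeries.delta, LSeries.logMul, invLogCoeff, show n ≠ 1 by omega, hlog]

theorem hasDerivAt_Ffun {s : ℂ} (hs : 1 / 2 < s.re) :
    HasDerivAt Ffun (-2 * (riemannZeta (2 * s) - 1)) s := by
  have hre : 1 < (2 * s).re := by
    simp only [Complex.mul_re, Complex.re_ofNat, Complex.im_ofNat]
    linarith
  have h := LSeries_hasDerivAt (abscissaOfAbsConv_invLogCoeff_le.trans_lt
    (by exact_mod_cast hre : (1 : EReal) < (2 * s).re))
  rw [LSeries_logMul_invLogCoeff hre] at h
  have h' := h.comp s ((hasDerivAt_id s).const_mul 2)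
  rw [funext Ffun_eq_LSeries]
  convert! h' using 1
  ring

theorem tendsto_sub_mul_deriv_Ffun :
    Tendsto (fun s ↦ (s - 1 / 2) * (-2 * (riemannZeta (2 * s) - 1))) (𝓝[≠] (1 / 2)) (𝓝 (-1)) := by
  have hcont : Tendsto (fun s : ℂ ↦ 2 * s) (𝓝 (1 / 2)) (𝓝 1) := by
    simpa using (tendsto_id (x := 𝓝 (1 / 2 : ℂ))).const_mul 2
  have hdouble : Tendsto (fun s : ℂ ↦ 2 * s) (𝓝[≠] (1 / 2)) (𝓝[≠] 1) := by
    refine tendsto_nhdsWithin_iff.2 ⟨hcont.mono_left nhdsWithin_le_nhds, ?_⟩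
    filter_upwards [self_mem_nhdsWithin] with s hs h
    rw [Set.mem_singleton_iff] at h
    exact hs (Set.mem_singleton_iff.2 (by linear_combination (1 / 2 : ℂ) * h))
  have h1 := riemannZeta_residue_one.comp hdouble
  have h2 := (hcont.mono_left (nhdsWithin_le_nhds (s := {1 / 2}ᶜ))).sub_const 1
  have h3 := h2.sub h1
  simp only [sub_self, zero_sub] at h3
  refine h3.congr fun s ↦ ?_
  simp only [Function.comp_apply]
  ring

/-- The function `F(s) = Σ_{n=2}^∞ n^{−2s}/log n` is holomorphic on
`{Re s > 1/2}` and admits no meromorphic continuation to the complex plane: there is no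
`h` meromorphic on all of `ℂ` with `h(s) = F(s)` for every `s` with `Re s > 1/2`. -/
theorem stmt16 :
    DifferentiableOn ℂ Ffun {s : ℂ | 1 / 2 < s.re} ∧
    ¬ ∃ h : ℂ → ℂ, MeromorphicOn h Set.univ ∧
      ∀ s : ℂ, 1 / 2 < s.re → h s = Ffun s := by
  refine ⟨fun s hs ↦ (hasDerivAt_Ffun hs).differentiableAt.differentiableWithinAt, ?_⟩
  rintro ⟨h, hmero, heq⟩
  set U : Set ℂ := {s : ℂ | 1 / 2 < s.re} with hU
  have hopen : IsOpen U := isOpen_lt continuous_const Complex.continuous_re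
  have hle : 𝓝[U] (1 / 2 : ℂ) ≤ 𝓝[≠] (1 / 2) := by
    refine nhdsWithin_mono _ fun s hs h ↦ ?_
    rw [Set.mem_singleton_iff] at h
    norm_num [hU, h] at hs
  have : (𝓝[U] (1 / 2 : ℂ)).NeBot := by
    rw [← mem_closure_iff_nhdsWithin_neBot, hU, Complex.closure_setOfPred_lt_re]
    norm_num
  refine neg_ne_zero.2 one_ne_zero ((hmero (1 / 2) trivial).eq_zero_of_tendsto_sub_mul_deriv hle
    ((tendsto_sub_mul_deriv_Ffun.mono_left hle).congr' ?_))
  filter_upwards [self_mem_nhdsWithin] with s hs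
  have hev : h =ᶠ[𝓝 s] Ffun := by
    filter_upwards [hopen.mem_nhds hs] with z hz using heq z hz
  rw [hev.deriv_eq, (hasDerivAt_Ffun hs).deriv]
end

section
/- For every β ∈ ℝ one has T^β(ℝ) ⊆ S^β(ℝ), and for all α, β ∈ ℝ with α < β one has S^α(ℝ) ⊆ T^β(ℝ). -/
open MeasureTheory Filter Topology
open scoped ENNReal NNReal

noncomputable section

/-- The Japanese bracket `⟨x⟩ = (1 + x²)^(1/2)`. -/
def jb (x : ℝ) : ℝ := Real.sqrt (1 + x ^ 2)

/-- The weight `‖f⁽ᵏ⁾(x)‖ ⟨x⟩^(k−β)` defining the `S^β` seminorms. -/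
def sWeight (β : ℝ) (k : ℕ) (f : ℝ → ℂ) (x : ℝ) : ℝ :=
  ‖iteratedDeriv k f x‖ * jb x ^ ((k : ℝ) - β)

/-- The `S^β` seminorm `‖f‖_{S^β,k} = sup_x ‖f⁽ᵏ⁾(x)‖ ⟨x⟩^(k−β)`. -/
def SNorm (β : ℝ) (k : ℕ) (f : ℝ → ℂ) : ℝ := ⨆ x : ℝ, sWeight β k f x

/-- Membership in `S^β(ℝ)`: smooth with all the seminorms finite. -/
def MemS (β : ℝ) (f : ℝ → ℂ) : Prop :=
  ContDiff ℝ (⊤ : ℕ∞) f ∧ ∀ k : ℕ, BddAbove (Set.range (sWeight β k f))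

/-- The weight `‖f⁽ᵏ⁾(x)‖ ⟨x⟩^(k−β−1)` defining the `T^β` seminorms. -/
def tWeight (β : ℝ) (k : ℕ) (f : ℝ → ℂ) (x : ℝ) : ℝ :=
  ‖iteratedDeriv k f x‖ * jb x ^ ((k : ℝ) - β - 1)

/-- The `T^β` seminorm `‖f‖_{T^β,k} = ∫ ‖f⁽ᵏ⁾(x)‖ ⟨x⟩^(k−β−1) dx`. -/
def TNorm (β : ℝ) (k : ℕ) (f : ℝ → ℂ) : ℝ := ∫ x : ℝ, tWeight β k f x

/-- Membership in `T^β(ℝ)`: smooth with all the seminorms finite. -/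
def MemT (β : ℝ) (f : ℝ → ℂ) : Prop :=
  ContDiff ℝ (⊤ : ℕ∞) f ∧ ∀ k : ℕ, Integrable (tWeight β k f)

/-- `F` is the sequence of divided differences of `f`: `F 0 = f`, each `F m` is
continuous, and the divided-difference recursion holds off the diagonal. -/
def IsDivDiff (f : ℝ → ℂ) (F : (m : ℕ) → (Fin (m + 1) → ℝ) → ℂ) : Prop :=
  (∀ x : Fin 1 → ℝ, F 0 x = f (x 0)) ∧
  (∀ m, Continuous (F m)) ∧
  (∀ m, ∀ x : Fin (m + 2) → ℝ, x 0 ≠ x (Fin.last (m + 1)) →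
    F (m + 1) x = (F m (fun i => x i.succ) - F m (fun i => x i.castSucc)) /
      ((x 0 - x (Fin.last (m + 1)) : ℝ) : ℂ))

end

lemma one_le_jb (x : ℝ) : 1 ≤ jb x :=
  Real.one_le_sqrt.2 (by nlinarith [sq_nonneg x])

lemma jb_pos (x : ℝ) : 0 < jb x := zero_lt_one.trans_le (one_le_jb x)

lemma abs_le_jb (x : ℝ) : |x| ≤ jb x := Real.abs_le_sqrt (by linarith)

lemma continuous_jb : Continuous jb := by
  unfold jb
  fun_prop

lemma continuous_jb_rpow (p : ℝ) : Continuous fun x => jb x ^ p :=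
  continuous_jb.rpow_const fun x => Or.inl (jb_pos x).ne'

lemma hasDerivAt_jb (x : ℝ) : HasDerivAt jb (x / jb x) x := by
  have h : HasDerivAt (fun y : ℝ => 1 + y ^ 2) (2 * x) x := by
    simpa using (hasDerivAt_pow 2 x).const_add 1
  rw [← mul_div_mul_left x (jb x) two_ne_zero]
  exact h.sqrt (by positivity)

lemma hasDerivAt_jb_rpow (p x : ℝ) :
    HasDerivAt (fun y => jb y ^ p) (x / jb x * p * jb x ^ (p - 1)) x :=
  (hasDerivAt_jb x).rpow_const (Or.inl (jb_pos x).ne')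

lemma integrable_jb_rpow {q : ℝ} (hq : q < -1) : Integrable fun x => jb x ^ q := by
  have h := integrable_rpow_neg_one_add_norm_sq (E := ℝ) (μ := volume) (r := -q)
    (by simp; linarith)
  refine h.congr (Eventually.of_forall fun x => ?_)
  have : (0 : ℝ) ≤ 1 + x ^ 2 := by positivity
  simp only [jb, Real.sqrt_eq_rpow, ← Real.rpow_mul this, Real.norm_eq_abs, sq_abs]
  ring_nf

lemma continuous_tWeight (β : ℝ) (k : ℕ) {f : ℝ → ℂ} (hf : ContDiff ℝ (⊤ : ℕ∞) f) :
    Continuous (tWeight β k f) :=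
  (hf.continuous_iteratedDeriv k (mod_cast le_top)).norm.mul (continuous_jb_rpow _)

/-- A function on the line with integrable continuous derivative is bounded. -/
lemma norm_le_of_integrable_deriv {g g' : ℝ → ℂ} (hg : ∀ x, HasDerivAt g (g' x) x)
    (hi : Integrable g') (x : ℝ) : ‖g x‖ ≤ ‖g 0‖ + ∫ y, ‖g' y‖ := by
  have h := intervalIntegral.integral_eq_sub_of_hasDerivAt (a := 0) (b := x)
    (fun y _ => hg y) hi.intervalIntegrable
  have hb : ‖g x - g 0‖ ≤ ∫ y, ‖g' y‖ := by
    rw [← h]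
    exact intervalIntegral.norm_integral_le_integral_norm_uIoc.trans
      (setIntegral_le_integral hi.norm (Eventually.of_forall fun y => norm_nonneg _))
  linarith [norm_sub_norm_le (g x) (g 0)]

lemma MemT.memS {β : ℝ} {f : ℝ → ℂ} (hf : MemT β f) : MemS β f := by
  obtain ⟨hs, hi⟩ := hf
  refine ⟨hs, fun k => ?_⟩
  set p : ℝ := k - β
  have hd (x : ℝ) : HasDerivAt (iteratedDeriv k f) (iteratedDeriv (k + 1) f x) x := by
    rw [iteratedDeriv_succ]
    exact (hs.differentiable_iteratedDeriv k
      (mod_cast ENat.natCast_lt_top k) x).hasDerivAt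
  have hg (x : ℝ) := (hd x).mul (hasDerivAt_jb_rpow p x).ofReal_comp
  have hc : Continuous fun x => ((x / jb x * p * jb x ^ (p - 1) : ℝ) : ℂ) :=
    Complex.continuous_ofReal.comp (((continuous_id.div continuous_jb
      fun x => (jb_pos x).ne').mul continuous_const).mul (continuous_jb_rpow _))
  have hck (m : ℕ) : Continuous (iteratedDeriv m f) :=
    hs.continuous_iteratedDeriv m (mod_cast le_top)
  have hint := ((hi (k + 1)).add ((hi k).const_mul |p|)).mono'
    (f := fun x => iteratedDeriv (k + 1) f x * ((jb x ^ p : ℝ) : ℂ) +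
      iteratedDeriv k f x * ((x / jb x * p * jb x ^ (p - 1) : ℝ) : ℂ))
    (((hck _).mul (Complex.continuous_ofReal.comp (continuous_jb_rpow p))).add
      ((hck _).mul hc)).aestronglyMeasurable
    (Eventually.of_forall fun x => by
      have hx : |x / jb x| ≤ 1 := by
        rw [abs_div, abs_of_pos (jb_pos x)]
        exact div_le_one_of_le₀ (abs_le_jb x) (jb_pos x).le
      have h0 (q : ℝ) : 0 ≤ jb x ^ q := Real.rpow_nonneg (jb_pos x).le q
      have he : ((k + 1 : ℕ) : ℝ) - β - 1 = p := by push_cast; ring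
      refine (norm_add_le _ _).trans (add_le_add (le_of_eq ?_) ?_)
      · rw [norm_mul, Complex.norm_real, Real.norm_of_nonneg (h0 p), tWeight, he]
      · rw [norm_mul, Complex.norm_real, Real.norm_eq_abs, abs_mul, abs_mul,
          abs_of_nonneg (h0 _)]
        calc ‖iteratedDeriv k f x‖ * (|x / jb x| * |p| * jb x ^ (p - 1))
            ≤ ‖iteratedDeriv k f x‖ * (1 * |p| * jb x ^ (p - 1)) := by
              have := h0 (p - 1)
              gcongr
          _ = |p| * (‖iteratedDeriv k f x‖ * jb x ^ (p - 1)) := by ring)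
  refine ⟨_, Set.forall_mem_range.2 fun x => le_trans (le_of_eq ?_)
    (norm_le_of_integrable_deriv hg hint x)⟩
  simp only [Pi.mul_apply, norm_mul, Complex.norm_real]
  rw [Real.norm_of_nonneg (Real.rpow_nonneg (jb_pos x).le p), sWeight]

lemma MemS.memT {α β : ℝ} (hαβ : α < β) {f : ℝ → ℂ} (hf : MemS α f) : MemT β f := by
  obtain ⟨hs, hb⟩ := hf
  refine ⟨hs, fun k => ?_⟩
  obtain ⟨C, hC⟩ := hb k
  refine ((integrable_jb_rpow (q := α - β - 1) (by linarith)).const_mul C).mono'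
    (continuous_tWeight β k hs).aestronglyMeasurable (Eventually.of_forall fun x => ?_)
  have h0 (q : ℝ) : 0 ≤ jb x ^ q := Real.rpow_nonneg (jb_pos x).le q
  have he : tWeight β k f x = sWeight α k f x * jb x ^ (α - β - 1) := by
    rw [tWeight, sWeight, mul_assoc, ← Real.rpow_add (jb_pos x)]
    ring_nf
  have hn : 0 ≤ tWeight β k f x := mul_nonneg (norm_nonneg _) (h0 _)
  rw [Real.norm_of_nonneg hn, he]
  exact mul_le_mul_of_nonneg_right (hC ⟨x, rfl⟩) (h0 _)

/-- For every `β ∈ ℝ` one has `T^β(ℝ) ⊆ S^β(ℝ)`, and for all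
`α, β ∈ ℝ` with `α < β` one has `S^α(ℝ) ⊆ T^β(ℝ)`. -/
theorem stmt18 :
    (∀ (β : ℝ) (f : ℝ → ℂ), MemT β f → MemS β f) ∧
    (∀ (α β : ℝ), α < β → ∀ f : ℝ → ℂ, MemS α f → MemT β f) :=
  ⟨fun _ _ hf => hf.memS, fun _ _ hαβ _ hf => hf.memT hαβ⟩
end
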